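/- Let E be any directed graph, K any field, and let x be a nonzero element of L_K(E). Then there exist paths α, β in E such that either (1) α* x β = k v for some vertex v ∈ E^0 and some nonzero k ∈ K, or (2) α* x β = p(c), where c is a cycle in E without an exit and p is a nonzero Laurent polynomial over K, with p(c) = Σ_{i=m}^{N} k_i c^i where c^i denotes (c*)^{-i} for i < 0 and c^0 denotes the vertex s(c). -/

import Mathlib

set_option synthInstance.maxHeartbeats 1000000
set_option maxHeartbeats 1000000

/-- Generators of the Leavitt path algebra: vertices, edges, and ghost edges. -/
inductive LPAGen (V E : Type) : Type
  | vertex : V → LPAGen V E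
  | edge : E → LPAGen V E
  | ghost : E → LPAGen V E

/-- The defining relations of the Leavitt path algebra of the graph with vertex set `V`,
edge set `E`, and source and range maps `s r : E → V`.  The (CK2) relation is imposed at
every regular vertex, i.e. every vertex emitting finitely many but at least one edge. -/
inductive LPARel (K : Type) [Field K] {V E : Type} (s r : E → V) :
    FreeAlgebra K (LPAGen V E) → FreeAlgebra K (LPAGen V E) → Prop
  | vertex_self (v : V) :
      LPARel K s r (FreeAlgebra.ι K (LPAGen.vertex v) * FreeAlgebra.ι K (LPAGen.vertex v))
        (FreeAlgebra.ι K (LPAGen.vertex v))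
  | vertex_ne {v w : V} (h : v ≠ w) :
      LPARel K s r (FreeAlgebra.ι K (LPAGen.vertex v) * FreeAlgebra.ι K (LPAGen.vertex w)) 0
  | edge_left (e : E) :
      LPARel K s r (FreeAlgebra.ι K (LPAGen.vertex (s e)) * FreeAlgebra.ι K (LPAGen.edge e))
        (FreeAlgebra.ι K (LPAGen.edge e))
  | edge_right (e : E) :
      LPARel K s r (FreeAlgebra.ι K (LPAGen.edge e) * FreeAlgebra.ι K (LPAGen.vertex (r e)))
        (FreeAlgebra.ι K (LPAGen.edge e))
  | ghost_left (e : E) :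
      LPARel K s r (FreeAlgebra.ι K (LPAGen.vertex (r e)) * FreeAlgebra.ι K (LPAGen.ghost e))
        (FreeAlgebra.ι K (LPAGen.ghost e))
  | ghost_right (e : E) :
      LPARel K s r (FreeAlgebra.ι K (LPAGen.ghost e) * FreeAlgebra.ι K (LPAGen.vertex (s e)))
        (FreeAlgebra.ι K (LPAGen.ghost e))
  | ck1_self (e : E) :
      LPARel K s r (FreeAlgebra.ι K (LPAGen.ghost e) * FreeAlgebra.ι K (LPAGen.edge e))
        (FreeAlgebra.ι K (LPAGen.vertex (r e)))
  | ck1_ne {e f : E} (h : e ≠ f) :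
      LPARel K s r (FreeAlgebra.ι K (LPAGen.ghost e) * FreeAlgebra.ι K (LPAGen.edge f)) 0
  | ck2 (v : V) (h : {e : E | s e = v}.Finite) (hne : {e : E | s e = v}.Nonempty) :
      LPARel K s r (FreeAlgebra.ι K (LPAGen.vertex v))
        (h.toFinset.sum fun e => FreeAlgebra.ι K (LPAGen.edge e) * FreeAlgebra.ι K (LPAGen.ghost e))

/-- The unital algebra presented by the Leavitt path algebra generators and relations
(for a graph with possibly infinitely many vertices this is the unitalization of the
Leavitt path algebra; the honest Leavitt path algebra is the non-unital subalgebra `lpa`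
generated by the generators, defined below). -/
abbrev LPAU (K : Type) [Field K] {V E : Type} (s r : E → V) : Type :=
  RingQuot (LPARel K s r)

variable (K : Type) [Field K] {V E : Type} (s r : E → V)

/-- The canonical image of a generator. -/
def gen (g : LPAGen V E) : LPAU K s r :=
  RingQuot.mkAlgHom K (LPARel K s r) (FreeAlgebra.ι K g)

def vertexEl (v : V) : LPAU K s r := gen K s r (LPAGen.vertex v)
def edgeEl (e : E) : LPAU K s r := gen K s r (LPAGen.edge e)
def ghostEl (e : E) : LPAU K s r := gen K s r (LPAGen.ghost e)

/-- The Leavitt path algebra `L_K(E)` of an arbitrary graph, realized (honestly, i.e.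
without an adjoined unit) as the non-unital subalgebra generated by the vertices, edges
and ghost edges. -/
def lpa : NonUnitalSubalgebra K (LPAU K s r) :=
  NonUnitalAlgebra.adjoin K (Set.range (gen K s r))

def vertexIn (v : V) : ↥(lpa K s r) :=
  ⟨vertexEl K s r v, NonUnitalAlgebra.subset_adjoin K (Set.mem_range_self _)⟩

def edgeIn (e : E) : ↥(lpa K s r) :=
  ⟨edgeEl K s r e, NonUnitalAlgebra.subset_adjoin K (Set.mem_range_self _)⟩

def ghostIn (e : E) : ↥(lpa K s r) :=
  ⟨ghostEl K s r e, NonUnitalAlgebra.subset_adjoin K (Set.mem_range_self _)⟩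

instance lpaNonUnitalRing : NonUnitalRing ↥(lpa K s r) := inferInstance
instance lpaAddCommGroup : AddCommGroup ↥(lpa K s r) := inferInstance
instance lpaModule : Module K ↥(lpa K s r) := inferInstance

/-- The element `v · e₁ e₂ ⋯ eₙ` of the algebra corresponding to a path starting at `v`
with edge list `es` (for the empty path this is the vertex `v` itself). -/
def pathEl (v : V) (es : List E) : LPAU K s r :=
  vertexEl K s r v * (es.map (edgeEl K s r)).prod

/-- The element `eₙ* ⋯ e₂* e₁* · v` corresponding to the ghost path `α*` of the path `α`
starting at `v` with edge list `es`. -/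
def ghostPathEl (v : V) (es : List E) : LPAU K s r :=
  (es.reverse.map (ghostEl K s r)).prod * vertexEl K s r v

/-- Paths in a directed graph: `IsPathFrom s r v w es` means the list of edges `es` is a
directed path from `v` to `w` (each vertex is a path of length `0`). -/
inductive IsPathFrom {V E : Type} (s r : E → V) : V → V → List E → Prop
  | nil (v : V) : IsPathFrom s r v v []
  | cons (e : E) {w : V} {es : List E} :
      IsPathFrom s r (r e) w es → IsPathFrom s r (s e) w (e :: es)

/-- `v ≥ w` : there is a path from `v` to `w`. -/
def Geq {V E : Type} (s r : E → V) (v w : V) : Prop :=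
  ∃ es : List E, IsPathFrom s r v w es

/-- A cycle based at `v` : a nonempty closed path whose source vertices are pairwise
distinct. -/
def IsCycle {V E : Type} (s r : E → V) (v : V) (es : List E) : Prop :=
  es ≠ [] ∧ IsPathFrom s r v v es ∧ (es.map s).Nodup

/-- A path (given by its list of edges) has an exit. -/
def HasExit {V E : Type} (s : E → V) (es : List E) : Prop :=
  ∃ f : E, ∃ e ∈ es, s f = s e ∧ f ≠ e

/-- A set of vertices is hereditary. -/
def Hereditary {V E : Type} (s r : E → V) (X : Set V) : Prop :=
  ∀ v ∈ X, ∀ w : V, Geq s r v w → w ∈ X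

/-- A set of vertices is saturated. -/
def Saturated {V E : Type} (s r : E → V) (X : Set V) : Prop :=
  ∀ v : V, {e : E | s e = v}.Finite → {e : E | s e = v}.Nonempty →
    (∀ e : E, s e = v → r e ∈ X) → v ∈ X

/-- The `i`-th power `cⁱ` of a cycle `c` (based at `v` with edge list `es`), for `i ∈ ℤ`:
`c⁰ = s(c)`, and for `i < 0`, `cⁱ = (c*)⁻ⁱ`. -/
noncomputable def cyclePow (K : Type) [Field K] {V E : Type} (s r : E → V)
    (v : V) (es : List E) (i : ℤ) : LPAU K s r :=
  if i = 0 then vertexEl K s r v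
  else if 0 < i then pathEl K s r v es ^ i.toNat
  else ghostPathEl K s r v es ^ (-i).toNat

section Relations

variable {K}

lemma vertexEl_mul_self (v : V) :
    vertexEl K s r v * vertexEl K s r v = vertexEl K s r v := by
  simpa [vertexEl, gen] using
    RingQuot.mkAlgHom_rel K (LPARel.vertex_self (K := K) (s := s) (r := r) v)

lemma vertexEl_mul_of_ne {v w : V} (h : v ≠ w) :
    vertexEl K s r v * vertexEl K s r w = 0 := by
  simpa [vertexEl, gen] using
    RingQuot.mkAlgHom_rel K (LPARel.vertex_ne (K := K) (s := s) (r := r) h)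

lemma vertexEl_mul_edgeEl (e : E) :
    vertexEl K s r (s e) * edgeEl K s r e = edgeEl K s r e := by
  simpa [vertexEl, edgeEl, gen] using
    RingQuot.mkAlgHom_rel K (LPARel.edge_left (K := K) (s := s) (r := r) e)

lemma edgeEl_mul_vertexEl (e : E) :
    edgeEl K s r e * vertexEl K s r (r e) = edgeEl K s r e := by
  simpa [vertexEl, edgeEl, gen] using
    RingQuot.mkAlgHom_rel K (LPARel.edge_right (K := K) (s := s) (r := r) e)

lemma vertexEl_mul_ghostEl (e : E) :
    vertexEl K s r (r e) * ghostEl K s r e = ghostEl K s r e := by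
  simpa [vertexEl, ghostEl, gen] using
    RingQuot.mkAlgHom_rel K (LPARel.ghost_left (K := K) (s := s) (r := r) e)

lemma ghostEl_mul_vertexEl (e : E) :
    ghostEl K s r e * vertexEl K s r (s e) = ghostEl K s r e := by
  simpa [vertexEl, ghostEl, gen] using
    RingQuot.mkAlgHom_rel K (LPARel.ghost_right (K := K) (s := s) (r := r) e)

lemma ghostEl_mul_edgeEl_self (e : E) :
    ghostEl K s r e * edgeEl K s r e = vertexEl K s r (r e) := by
  simpa [vertexEl, ghostEl, edgeEl, gen] using
    RingQuot.mkAlgHom_rel K (LPARel.ck1_self (K := K) (s := s) (r := r) e)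

lemma ghostEl_mul_edgeEl_of_ne {e f : E} (h : e ≠ f) :
    ghostEl K s r e * edgeEl K s r f = 0 := by
  simpa [ghostEl, edgeEl, gen] using
    RingQuot.mkAlgHom_rel K (LPARel.ck1_ne (K := K) (s := s) (r := r) h)

lemma vertexEl_eq_sum (v : V) (h : {e : E | s e = v}.Finite) (hne : {e : E | s e = v}.Nonempty) :
    vertexEl K s r v = ∑ e ∈ h.toFinset, edgeEl K s r e * ghostEl K s r e := by
  simpa [vertexEl, ghostEl, edgeEl, gen] using
    RingQuot.mkAlgHom_rel K (LPARel.ck2 (K := K) (s := s) (r := r) v h hne)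

variable {s r}

lemma vertexEl_mul_edgeEl_of_ne {v : V} {e : E} (h : v ≠ s e) :
    vertexEl K s r v * edgeEl K s r e = 0 := by
  rw [← vertexEl_mul_edgeEl, ← mul_assoc, vertexEl_mul_of_ne s r h, zero_mul]

lemma edgeEl_mul_vertexEl_of_ne {v : V} {e : E} (h : r e ≠ v) :
    edgeEl K s r e * vertexEl K s r v = 0 := by
  rw [← edgeEl_mul_vertexEl, mul_assoc, vertexEl_mul_of_ne s r h, mul_zero]

lemma ghostEl_mul_vertexEl_of_ne {v : V} {e : E} (h : s e ≠ v) :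
    ghostEl K s r e * vertexEl K s r v = 0 := by
  rw [← ghostEl_mul_vertexEl, mul_assoc, vertexEl_mul_of_ne s r h, mul_zero]

end Relations

section Paths

variable {K} {s r}

lemma IsPathFrom.append {u v w : V} {a b : List E} (ha : IsPathFrom s r u v a)
    (hb : IsPathFrom s r v w b) : IsPathFrom s r u w (a ++ b) := by
  induction ha with
  | nil => exact hb
  | cons e _ ih => exact .cons e (ih hb)

lemma IsPathFrom.single (e : E) : IsPathFrom s r (s e) (r e) [e] := .cons e (.nil _)

lemma isPathFrom_nil_iff {v w : V} : IsPathFrom s r v w [] ↔ v = w :=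
  ⟨fun h => by cases h; rfl, fun h => h ▸ .nil _⟩

lemma isPathFrom_cons_iff {v w : V} {e : E} {es : List E} :
    IsPathFrom s r v w (e :: es) ↔ s e = v ∧ IsPathFrom s r (r e) w es :=
  ⟨fun h => by cases h with | cons _ h => exact ⟨rfl, h⟩, fun ⟨h, h'⟩ => h ▸ .cons e h'⟩

lemma isPathFrom_append_iff {u w : V} {a b : List E} :
    IsPathFrom s r u w (a ++ b) ↔ ∃ v, IsPathFrom s r u v a ∧ IsPathFrom s r v w b := by
  refine ⟨fun h => ?_, fun ⟨v, h, h'⟩ => h.append h'⟩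
  induction a generalizing u with
  | nil => exact ⟨u, .nil u, h⟩
  | cons e a ih =>
    obtain ⟨rfl, h'⟩ := isPathFrom_cons_iff.1 h
    obtain ⟨v, h₁, h₂⟩ := ih h'
    exact ⟨v, .cons e h₁, h₂⟩

lemma IsPathFrom.of_append {u v w : V} {a b : List E} (ha : IsPathFrom s r u v a)
    (hab : IsPathFrom s r u w (a ++ b)) : IsPathFrom s r v w b := by
  induction ha with
  | nil => exact hab
  | cons e _ ih => exact ih (isPathFrom_cons_iff.1 hab).2

@[simp] lemma pathEl_nil (v : V) : pathEl K s r v [] = vertexEl K s r v := by simp [pathEl]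

@[simp] lemma ghostPathEl_nil (v : V) : ghostPathEl K s r v [] = vertexEl K s r v := by
  simp [ghostPathEl]

lemma pathEl_cons (e : E) (es : List E) :
    pathEl K s r (s e) (e :: es) = edgeEl K s r e * pathEl K s r (r e) es := by
  simp only [pathEl, List.map_cons, List.prod_cons]
  rw [← mul_assoc, ← mul_assoc, vertexEl_mul_edgeEl, edgeEl_mul_vertexEl]

lemma ghostPathEl_cons (e : E) (es : List E) :
    ghostPathEl K s r (s e) (e :: es) = ghostPathEl K s r (r e) es * ghostEl K s r e := by
  simp [ghostPathEl, mul_assoc, ghostEl_mul_vertexEl, vertexEl_mul_ghostEl]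

lemma ghostPathEl_concat (v : V) (es : List E) (e : E) :
    ghostPathEl K s r v (es ++ [e]) = ghostEl K s r e * ghostPathEl K s r v es := by
  simp [ghostPathEl, mul_assoc]

lemma vertexEl_mul_pathEl (v : V) (es : List E) :
    vertexEl K s r v * pathEl K s r v es = pathEl K s r v es := by
  rw [pathEl, ← mul_assoc, vertexEl_mul_self]

lemma vertexEl_mul_pathEl_of_ne {v w : V} (h : v ≠ w) (es : List E) :
    vertexEl K s r v * pathEl K s r w es = 0 := by
  rw [pathEl, ← mul_assoc, vertexEl_mul_of_ne s r h, zero_mul]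

lemma ghostPathEl_mul_vertexEl (v : V) (es : List E) :
    ghostPathEl K s r v es * vertexEl K s r v = ghostPathEl K s r v es := by
  rw [ghostPathEl, mul_assoc, vertexEl_mul_self]

lemma ghostPathEl_mul_vertexEl_of_ne {v w : V} (h : v ≠ w) (es : List E) :
    ghostPathEl K s r v es * vertexEl K s r w = 0 := by
  rw [ghostPathEl, mul_assoc, vertexEl_mul_of_ne s r h, mul_zero]

lemma pathEl_append {v w : V} {a : List E} (h : IsPathFrom s r v w a) (b : List E) :
    pathEl K s r v (a ++ b) = pathEl K s r v a * pathEl K s r w b := by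
  induction h with
  | nil v => simp [vertexEl_mul_pathEl]
  | cons e _ ih => rw [List.cons_append, pathEl_cons, ih, pathEl_cons, mul_assoc]

lemma pathEl_mul_vertexEl {v w : V} {a : List E} (h : IsPathFrom s r v w a) :
    pathEl K s r v a * vertexEl K s r w = pathEl K s r v a := by
  rw [← pathEl_nil, ← pathEl_append h, List.append_nil]

lemma ghostPathEl_mul_pathEl_self {v w : V} {a : List E} (h : IsPathFrom s r v w a) :
    ghostPathEl K s r v a * pathEl K s r v a = vertexEl K s r w := by
  induction h with
  | nil v => simp [vertexEl_mul_self]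
  | cons e _ ih =>
    rw [ghostPathEl_cons, pathEl_cons, mul_assoc, ← mul_assoc (ghostEl K s r e),
      ghostEl_mul_edgeEl_self, vertexEl_mul_pathEl, ih]

/-- If `b` is at least as long as `a`, then `a* b` is zero or the path that remains when the
prefix `a` is removed from `b`. -/
lemma ghostPathEl_mul_pathEl {u v w : V} {a b : List E} (ha : IsPathFrom s r u v a)
    (hb : IsPathFrom s r u w b) (hab : a.length ≤ b.length) :
    ghostPathEl K s r u a * pathEl K s r u b = 0 ∨
      ∃ c, b = a ++ c ∧ IsPathFrom s r v w c ∧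
        ghostPathEl K s r u a * pathEl K s r u b = pathEl K s r v c := by
  induction ha generalizing b with
  | nil v => exact .inr ⟨b, rfl, hb, by simp [vertexEl_mul_pathEl]⟩
  | cons e _ ih =>
    cases b with
    | nil => simp at hab
    | cons f b =>
      obtain ⟨hf, hb⟩ := isPathFrom_cons_iff.1 hb
      rw [ghostPathEl_cons, ← hf, pathEl_cons, mul_assoc, ← mul_assoc (ghostEl K s r e)]
      by_cases hef : e = f
      · subst hef
        rw [ghostEl_mul_edgeEl_self, vertexEl_mul_pathEl]
        rcases ih hb (by simpa using hab) with h | ⟨c, rfl, hc, h⟩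
        · exact .inl h
        · exact .inr ⟨c, rfl, hc, h⟩
      · exact .inl (by rw [ghostEl_mul_edgeEl_of_ne s r hef, zero_mul, mul_zero])

end Paths

section Reducible

/-- The conclusion of the reduction theorem for `x`, with the sources of the two paths
prescribed. -/
def Reducible (u v : V) (x : LPAU K s r) : Prop :=
  ∃ (wa wb : V) (esa esb : List E),
    IsPathFrom s r u wa esa ∧ IsPathFrom s r v wb esb ∧
    ((∃ (v' : V) (k : K), k ≠ 0 ∧
        ghostPathEl K s r u esa * x * pathEl K s r v esb = k • vertexEl K s r v') ∨
      (∃ (v' : V) (esc : List E), IsCycle s r v' esc ∧ ¬ HasExit s esc ∧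
        ∃ p : ℤ →₀ K, p ≠ 0 ∧
          ghostPathEl K s r u esa * x * pathEl K s r v esb =
            p.sum fun i k => k • cyclePow K s r v' esc i))

variable {K} {s r}

lemma Reducible.of_mul_edgeEl {u : V} {e : E} {x : LPAU K s r}
    (h : Reducible K s r u (r e) (x * edgeEl K s r e)) : Reducible K s r u (s e) x := by
  obtain ⟨wa, wb, a, b, ha, hb, h⟩ := h
  refine ⟨wa, wb, a, e :: b, ha, .cons e hb, ?_⟩
  simpa only [pathEl_cons, mul_assoc] using h

lemma Reducible.of_ghostEl_mul {v : V} {e : E} {x : LPAU K s r}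
    (h : Reducible K s r (r e) v (ghostEl K s r e * x)) : Reducible K s r (s e) v x := by
  obtain ⟨wa, wb, a, b, ha, hb, h⟩ := h
  refine ⟨wa, wb, e :: a, b, .cons e ha, hb, ?_⟩
  simpa only [ghostPathEl_cons, mul_assoc] using h

lemma Reducible.of_ghostPathEl_mul {u v w : V} {a : List E} {x : LPAU K s r}
    (ha : IsPathFrom s r u w a)
    (h : Reducible K s r w v (ghostPathEl K s r u a * x)) : Reducible K s r u v x := by
  induction ha generalizing x with
  | nil u =>
    obtain ⟨wa, wb, a, b, ha, hb, h⟩ := h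
    refine ⟨wa, wb, a, b, ha, hb, ?_⟩
    simpa only [ghostPathEl_nil, ← mul_assoc, ghostPathEl_mul_vertexEl] using h
  | cons e _ ih =>
    rw [ghostPathEl_cons, mul_assoc] at h
    exact (ih h).of_ghostEl_mul

lemma reducible_smul_vertexEl (v : V) {k : K} (hk : k ≠ 0) :
    Reducible K s r v v (k • vertexEl K s r v) :=
  ⟨v, v, [], [], .nil v, .nil v, .inl ⟨v, k, hk, by simp [vertexEl_mul_self]⟩⟩

end Reducible

section ClosedPaths

/-- A nonempty closed path based at `v`. -/
def IsClosedPath {V E : Type} (s r : E → V) (v : V) (c : List E) : Prop :=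
  c ≠ [] ∧ IsPathFrom s r v v c

/-- The linear span of the nonempty closed paths based at `v`. -/
def closedPathSpan (v : V) : Submodule K (LPAU K s r) :=
  Submodule.span K (pathEl K s r v '' {c | IsClosedPath s r v c})

variable {K} {s r}

lemma IsClosedPath.rotate {v : V} {e : E} {c : List E} (h : IsClosedPath s r v (e :: c)) :
    IsClosedPath s r (r e) (c ++ [e]) := by
  obtain ⟨rfl, hc⟩ := isPathFrom_cons_iff.1 h.2
  exact ⟨by simp, hc.append (.single e)⟩

lemma ghostEl_mul_pathEl_mul_edgeEl_self {v : V} {e : E} {c : List E}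
    (h : IsClosedPath s r v (e :: c)) :
    ghostEl K s r e * pathEl K s r v (e :: c) * edgeEl K s r e =
      pathEl K s r (r e) (c ++ [e]) := by
  obtain ⟨rfl, hc⟩ := isPathFrom_cons_iff.1 h.2
  rw [pathEl_cons, ← mul_assoc, ghostEl_mul_edgeEl_self, vertexEl_mul_pathEl, pathEl_append hc,
    pathEl_cons, pathEl_nil, edgeEl_mul_vertexEl]

lemma ghostEl_mul_pathEl_of_ne {v w : V} {e f : E} {c : List E} (hef : e ≠ f)
    (h : IsPathFrom s r v w (f :: c)) : ghostEl K s r e * pathEl K s r v (f :: c) = 0 := by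
  obtain ⟨rfl, hc⟩ := isPathFrom_cons_iff.1 h
  rw [pathEl_cons, ← mul_assoc, ghostEl_mul_edgeEl_of_ne s r hef, zero_mul]

/-- The linear combination of paths based at `v` encoded by a list of coefficients and paths. -/
def listEl (v : V) (L : List (K × List E)) : LPAU K s r :=
  (L.map fun t => t.1 • pathEl K s r v t.2).sum

lemma exists_list_of_mem_closedPathSpan {v : V} {z : LPAU K s r}
    (hz : z ∈ closedPathSpan K s r v) :
    ∃ L : List (K × List E), (∀ t ∈ L, IsClosedPath s r v t.2) ∧ z = listEl v L := by
  induction hz using Submodule.span_induction with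
  | mem x hx =>
    obtain ⟨c, hc, rfl⟩ := hx
    exact ⟨[(1, c)], by simpa using hc, by simp [listEl]⟩
  | zero => exact ⟨[], by simp, by simp [listEl]⟩
  | add x y _ _ hx hy =>
    obtain ⟨L, hL, rfl⟩ := hx
    obtain ⟨M, hM, rfl⟩ := hy
    refine ⟨L ++ M, fun t ht => ?_, by simp [listEl]⟩
    rcases List.mem_append.1 ht with h | h
    exacts [hL t h, hM t h]
  | smul k x _ hx =>
    obtain ⟨L, hL, rfl⟩ := hx
    refine ⟨L.map fun t => (k * t.1, t.2), fun t ht => ?_, ?_⟩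
    · obtain ⟨t', h, rfl⟩ := List.mem_map.1 ht
      exact hL t' h
    · simp [listEl, List.smul_sum, Function.comp_def, mul_smul]

lemma exists_finset_ghostEl_mul_eq_zero {v : V} {z : LPAU K s r}
    (hz : z ∈ closedPathSpan K s r v) :
    ∃ H : Finset E, ∀ f ∉ H, ghostEl K s r f * z = 0 := by
  classical
  induction hz using Submodule.span_induction with
  | mem x hx =>
    obtain ⟨c, hc, rfl⟩ := hx
    match c, hc with
    | [], hc => exact absurd rfl hc.1
    | e :: c, hc =>
      exact ⟨{e}, fun f hf => ghostEl_mul_pathEl_of_ne (by simpa using hf) hc.2⟩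
  | zero => exact ⟨∅, by simp⟩
  | add x y _ _ hx hy =>
    obtain ⟨H, hH⟩ := hx
    obtain ⟨H', hH'⟩ := hy
    refine ⟨H ∪ H', fun f hf => ?_⟩
    simp only [Finset.mem_union, not_or] at hf
    rw [mul_add, hH f hf.1, hH' f hf.2, add_zero]
  | smul k x _ hx =>
    obtain ⟨H, hH⟩ := hx
    exact ⟨H, fun f hf => by rw [mul_smul_comm, hH f hf, smul_zero]⟩

open Classical in
/-- The effect on a list of closed paths of conjugating by the edge `f`: the paths that start
with `f` are rotated and the others disappear. -/
noncomputable def conjList {R : Type} (f : E) (L : List (R × List E)) : List (R × List E) :=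
  L.filterMap fun t => if t.2.head? = some f then some (t.1, t.2.tail ++ [f]) else none

lemma mem_conjList {R : Type} {f : E} {L : List (R × List E)} {t : R × List E} :
    t ∈ conjList f L ↔ ∃ c, (t.1, f :: c) ∈ L ∧ t.2 = c ++ [f] := by
  classical
  simp only [conjList, List.mem_filterMap, Option.ite_none_right_eq_some, Option.some.injEq]
  constructor
  · rintro ⟨⟨k, c⟩, hL, hc, rfl⟩
    cases c with
    | nil => simp at hc
    | cons e c =>
      obtain rfl : e = f := by simpa using hc
      exact ⟨c, hL, rfl⟩
  · rintro ⟨c, hL, hc⟩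
    exact ⟨_, hL, by simp, by ext <;> simp [hc]⟩

lemma length_conjList_le {R : Type} (f : E) (L : List (R × List E)) :
    (conjList f L).length ≤ L.length :=
  List.length_filterMap_le _ _

lemma length_conjList_lt {R : Type} {f : E} {L : List (R × List E)} {t : R × List E}
    (ht : t ∈ L) (hf : t.2.head? ≠ some f) : (conjList f L).length < L.length := by
  classical
  induction L with
  | nil => simp at ht
  | cons t' L ih =>
    have hle := length_conjList_le f L
    rcases List.mem_cons.1 ht with rfl | ht
    · simp only [conjList] at hle ⊢
      simp only [List.filterMap_cons, hf, if_false, List.length_cons]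
      omega
    · have := ih ht
      simp only [conjList] at this ⊢
      rw [List.filterMap_cons]
      split <;> simp only [List.length_cons] <;> omega

lemma isClosedPath_of_mem_conjList {R : Type} {v : V} {f : E} {L : List (R × List E)}
    (hL : ∀ t ∈ L, IsClosedPath s r v t.2) :
    ∀ t ∈ conjList f L, IsClosedPath s r (r f) t.2 := by
  intro t ht
  obtain ⟨c, hc, h⟩ := mem_conjList.1 ht
  rw [h]
  exact (hL _ hc).rotate

lemma ghostEl_mul_listEl_mul_edgeEl {v : V} {f : E} {L : List (K × List E)}
    (hL : ∀ t ∈ L, IsClosedPath s r v t.2) :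
    ghostEl K s r f * listEl v L * edgeEl K s r f = listEl (r f) (conjList f L) := by
  classical
  induction L with
  | nil => simp [listEl, conjList]
  | cons t L ih =>
    have hL' : ∀ t ∈ L, IsClosedPath s r v t.2 := fun t ht => hL t (List.mem_cons_of_mem _ ht)
    have ht := hL t List.mem_cons_self
    have ih := ih hL'
    have key : ghostEl K s r f * listEl v (t :: L) * edgeEl K s r f =
        t.1 • (ghostEl K s r f * pathEl K s r v t.2 * edgeEl K s r f) +
          listEl (r f) (conjList f L) := by
      rw [← ih]
      simp [listEl, mul_add, add_mul]
    rw [key]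
    obtain ⟨k, c⟩ := t
    match c, ht with
    | [], ht => exact absurd rfl ht.1
    | e :: c, ht =>
      by_cases hef : e = f
      · subst hef
        rw [ghostEl_mul_pathEl_mul_edgeEl_self ht]
        simp [listEl, conjList]
      · rw [ghostEl_mul_pathEl_of_ne (Ne.symm hef) ht.2]
        simp [listEl, conjList, hef]

lemma reducible_of_conj {v : V} {f : E} (hf : s f = v) {k : K} {L : List (K × List E)}
    (hL : ∀ t ∈ L, IsClosedPath s r v t.2)
    (h : Reducible K s r (r f) (r f)
      (k • vertexEl K s r (r f) + listEl (r f) (conjList f L))) :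
    Reducible K s r v v (k • vertexEl K s r v + listEl v L) := by
  subst hf
  apply Reducible.of_ghostEl_mul
  apply Reducible.of_mul_edgeEl
  rwa [mul_add, add_mul, ghostEl_mul_listEl_mul_edgeEl hL, mul_smul_comm, smul_mul_assoc,
    ghostEl_mul_vertexEl, ghostEl_mul_edgeEl_self]

lemma IsClosedPath.exists_source {v : V} {c : List E} (hc : IsClosedPath s r v c) :
    ∃ e ∈ c, s e = v := by
  match c, hc with
  | [], hc => exact absurd rfl hc.1
  | e :: c, hc => exact ⟨e, by simp, (isPathFrom_cons_iff.1 hc.2).1⟩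

lemma IsClosedPath.exists_source_eq_range {v : V} {c : List E} (hc : IsClosedPath s r v c)
    {e : E} (he : e ∈ c) : ∃ f ∈ c, s f = r e := by
  obtain ⟨a, b, rfl⟩ := List.append_of_mem he
  obtain ⟨w, -, h⟩ := isPathFrom_append_iff.1 hc.2
  obtain ⟨-, h⟩ := isPathFrom_cons_iff.1 h
  cases b with
  | nil =>
    rw [isPathFrom_nil_iff.1 h]
    exact hc.exists_source
  | cons f b => exact ⟨f, by simp, (isPathFrom_cons_iff.1 h).1⟩

/-- Paths from a closed path without exits stay on that closed path. -/
lemma mem_of_isPathFrom_of_not_hasExit {v : V} {c : List E} (hc : IsClosedPath s r v c)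
    (hx : ¬ HasExit s c) {u w : V} {a : List E} (hu : ∃ e ∈ c, s e = u)
    (ha : IsPathFrom s r u w a) : ∀ e ∈ a, e ∈ c := by
  induction ha with
  | nil => simp
  | cons f _ ih =>
    obtain ⟨e, he, hef⟩ := hu
    obtain rfl : f = e := by
      by_contra h
      exact hx ⟨f, e, he, hef.symm, h⟩
    intro e' he'
    rcases List.mem_cons.1 he' with rfl | h
    exacts [he, ih (hc.exists_source_eq_range he) e' h]

lemma exists_append_of_not_hasExit {u w w' : V} {a b : List E} (hx : ¬ HasExit s a)
    (ha : IsPathFrom s r u w a) (hb : IsPathFrom s r u w' b) (hab : a.length ≤ b.length) :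
    ∃ c, b = a ++ c := by
  induction ha generalizing b with
  | nil => exact ⟨b, rfl⟩
  | @cons e w a _ ih =>
    cases b with
    | nil => simp at hab
    | cons f b =>
      obtain ⟨hf, hb'⟩ := isPathFrom_cons_iff.1 hb
      obtain rfl : f = e := by
        by_contra h
        exact hx ⟨f, e, by simp, hf, h⟩
      obtain ⟨c, rfl⟩ := ih (fun ⟨f, e, he, h⟩ => hx ⟨f, e, by simp [he], h⟩) hb'
        (by simpa using hab)
      exact ⟨c, rfl⟩

/-- A nonempty closed path of minimal length at `v` is a cycle. -/
lemma IsClosedPath.isCycle_of_minimal {v : V} {c : List E} (hc : IsClosedPath s r v c)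
    (hmin : ∀ d, IsClosedPath s r v d → c.length ≤ d.length) : IsCycle s r v c := by
  refine ⟨hc.1, hc.2, ?_⟩
  rw [List.Nodup, List.pairwise_map]
  by_contra h
  obtain ⟨a, e, b, e', d, rfl, hs⟩ : ∃ a e b e' d, c = a ++ e :: (b ++ e' :: d) ∧ s e = s e' := by
    clear hc hmin
    induction c with
    | nil => simp at h
    | cons e c ih =>
      rw [List.pairwise_cons] at h
      by_cases h' : ∀ a' ∈ c, s e ≠ s a'
      · obtain ⟨a, e₁, b, e', d, rfl, hs⟩ := ih fun hp => h ⟨h', hp⟩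
        exact ⟨e :: a, e₁, b, e', d, rfl, hs⟩
      · push Not at h'
        obtain ⟨e', he', hs⟩ := h'
        obtain ⟨b, d, rfl⟩ := List.append_of_mem he'
        exact ⟨[], e, b, e', d, rfl, hs⟩
  obtain ⟨w, h₁, h₂⟩ := isPathFrom_append_iff.1 hc.2
  obtain ⟨rfl, h₃⟩ := isPathFrom_cons_iff.1 h₂
  obtain ⟨w', -, h₄⟩ := isPathFrom_append_iff.1 h₃
  obtain ⟨rfl, -⟩ := isPathFrom_cons_iff.1 h₄
  have := hmin (a ++ e' :: d) ⟨by simp, h₁.append (hs ▸ h₄)⟩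
  simp only [List.length_append, List.length_cons] at this
  omega

/-- If some closed path at `v` has no exit, then there is a cycle without exits at `v` of which
every closed path at `v` is a power. -/
lemma IsClosedPath.exists_cycle {v : V} {c : List E} (hc : IsClosedPath s r v c)
    (hx : ¬ HasExit s c) :
    ∃ d, IsCycle s r v d ∧ ¬ HasExit s d ∧
      ∀ a, IsClosedPath s r v a → ∃ m : ℕ, 0 < m ∧ pathEl K s r v a = pathEl K s r v d ^ m := by
  obtain ⟨d, hd, hmin⟩ :=
    exists_minimalFor_of_wellFoundedLT (IsClosedPath s r v) List.length ⟨c, hc⟩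
  replace hmin : ∀ a, IsClosedPath s r v a → d.length ≤ a.length := fun a ha =>
    (le_total d.length a.length).elim id fun h => hmin ha h
  have hdx : ¬ HasExit s d := fun ⟨f, e, he, h⟩ =>
    hx ⟨f, e, mem_of_isPathFrom_of_not_hasExit hc hx hc.exists_source hd.2 e he, h⟩
  refine ⟨d, hd.isCycle_of_minimal hmin, hdx, fun a ha => ?_⟩
  induction hn : a.length using Nat.strong_induction_on generalizing a with
  | _ n ih =>
    obtain ⟨b, rfl⟩ := exists_append_of_not_hasExit hdx hd.2 ha.2 (hmin a ha)
    by_cases hb : b = []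
    · exact ⟨1, one_pos, by simp [hb]⟩
    have hdpos := List.length_pos_of_ne_nil hd.1
    obtain ⟨m, hm, h⟩ := ih b.length (by simp at hn; omega) b ⟨hb, hd.2.of_append ha.2⟩ rfl
    exact ⟨m + 1, m.succ_pos, by rw [pathEl_append hd.2, h, pow_succ']⟩

end ClosedPaths

section Reduction

variable {K} {s r}

lemma cyclePow_natCast {v : V} {d : List E} {m : ℕ} (hm : 0 < m) :
    cyclePow K s r v d m = pathEl K s r v d ^ m := by
  simp [cyclePow, hm, hm.ne']

lemma exists_laurent_eq {v : V} {d : List E}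
    (hd : ∀ a, IsClosedPath s r v a →
      ∃ m : ℕ, 0 < m ∧ pathEl K s r v a = pathEl K s r v d ^ m)
    (k : K) {L : List (K × List E)} (hL : ∀ t ∈ L, IsClosedPath s r v t.2) :
    ∃ p : ℤ →₀ K, p 0 = k ∧
      k • vertexEl K s r v + listEl v L = p.sum fun i k => k • cyclePow K s r v d i := by
  induction L with
  | nil => exact ⟨.single 0 k, by simp, by simp [listEl, cyclePow]⟩
  | cons t L ih =>
    obtain ⟨p, hp, h⟩ := ih fun t ht => hL t (List.mem_cons_of_mem _ ht)
    obtain ⟨m, hm, ht⟩ := hd t.2 (hL t List.mem_cons_self)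
    refine ⟨.single (m : ℤ) t.1 + p, by simp [hp, hm.ne'], ?_⟩
    rw [Finsupp.sum_add_index' (by simp) (by simp [add_smul]), ← h,
      Finsupp.sum_single_index (by simp), cyclePow_natCast hm, ← ht]
    simp [listEl, add_left_comm]

/-- Induction step for `reducible_smul_vertexEl_add_listEl`: a closed path with an exit
allows one to shorten the list. -/
lemma reducible_of_exit {k : K} {N : ℕ}
    (ih : ∀ (v : V) (L : List (K × List E)), L.length < N → (∀ t ∈ L, IsClosedPath s r v t.2) →
      Reducible K s r v v (k • vertexEl K s r v + listEl v L))
    {v : V} {L : List (K × List E)} (hN : L.length ≤ N)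
    (hL : ∀ t ∈ L, IsClosedPath s r v t.2) {l : K} {a b : List E} {e f : E}
    (ht : (l, a ++ e :: b) ∈ L) (hf : s f = s e) (hfe : f ≠ e) :
    Reducible K s r v v (k • vertexEl K s r v + listEl v L) := by
  induction a generalizing v L b with
  | nil =>
    have hv := (isPathFrom_cons_iff.1 (hL _ ht).2).1
    refine reducible_of_conj (hf.trans hv) hL (ih _ _ ?_ (isClosedPath_of_mem_conjList hL))
    exact (length_conjList_lt ht (by simpa using hfe.symm)).trans_le hN
  | cons g a iha =>
    have hv := (isPathFrom_cons_iff.1 (hL _ ht).2).1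
    refine reducible_of_conj hv hL (iha (b := b ++ [g]) ((length_conjList_le g L).trans hN)
      (isClosedPath_of_mem_conjList hL) (mem_conjList.2 ⟨_, ht, by simp⟩))

lemma reducible_smul_vertexEl_add_listEl {k : K} (hk : k ≠ 0) (v : V) (L : List (K × List E))
    (hL : ∀ t ∈ L, IsClosedPath s r v t.2) :
    Reducible K s r v v (k • vertexEl K s r v + listEl v L) := by
  induction hN : L.length using Nat.strong_induction_on generalizing v L with
  | _ N ih =>
    match L, hL, hN with
    | [], _, _ => simpa [listEl] using reducible_smul_vertexEl v hk
    | t :: L, hL, hN =>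
      by_cases hx : HasExit s t.2
      · obtain ⟨f, e, he, hf, hfe⟩ := hx
        obtain ⟨a, b, hab⟩ := List.append_of_mem he
        exact reducible_of_exit (fun v L h h' => ih _ h v L h' rfl) hN.le hL (l := t.1)
          (a := a) (b := b) (by simp [← hab]) hf hfe
      · obtain ⟨d, hd, hdx, hpow⟩ := (hL t List.mem_cons_self).exists_cycle (K := K) hx
        obtain ⟨p, hp, h⟩ := exists_laurent_eq hpow k hL
        refine ⟨v, v, [], [], .nil v, .nil v, .inr ⟨v, d, hd, hdx, p, ?_, ?_⟩⟩
        · rintro rfl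
          exact hk hp.symm
        · rw [← h]
          have hz : ∀ M : List (K × List E), (∀ t ∈ M, IsClosedPath s r v t.2) →
              vertexEl K s r v * listEl v M * vertexEl K s r v = listEl v M := by
            intro M hM
            induction M with
            | nil => simp [listEl]
            | cons t M ihM =>
              have h₁ := ihM fun t ht => hM t (List.mem_cons_of_mem _ ht)
              have h₂ := pathEl_mul_vertexEl (K := K) (hM t List.mem_cons_self).2
              simp only [listEl, List.map_cons, List.sum_cons] at h₁ ⊢
              rw [mul_add, add_mul, h₁, mul_smul_comm, smul_mul_assoc, vertexEl_mul_pathEl, h₂]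
          simp only [pathEl_nil, ghostPathEl_nil]
          rw [mul_add, add_mul, hz _ hL, mul_smul_comm, smul_mul_assoc, vertexEl_mul_self,
            vertexEl_mul_self]

lemma reducible_smul_vertexEl_add {k : K} (hk : k ≠ 0) {v : V} {z : LPAU K s r}
    (hz : z ∈ closedPathSpan K s r v) : Reducible K s r v v (k • vertexEl K s r v + z) := by
  obtain ⟨L, hL, rfl⟩ := exists_list_of_mem_closedPathSpan hz
  exact reducible_smul_vertexEl_add_listEl hk v L hL

variable (K s r) in
/-- The span of the paths from `u` to `v`. -/
def pathSpan (u v : V) : Submodule K (LPAU K s r) :=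
  Submodule.span K (pathEl K s r u '' {a | IsPathFrom s r u v a})

lemma mul_vertexEl_of_mem_pathSpan {u v : V} {b : LPAU K s r} (hb : b ∈ pathSpan K s r u v) :
    b * vertexEl K s r v = b := by
  induction hb using Submodule.span_induction with
  | mem x hx =>
    obtain ⟨a, ha, rfl⟩ := hx
    exact pathEl_mul_vertexEl ha
  | zero => simp
  | add x y _ _ hx hy => rw [add_mul, hx, hy]
  | smul k x _ hx => rw [smul_mul_assoc, hx]

/-- A nonzero combination of paths can be brought into the form `k v + z`, with `k ≠ 0` and
`z` a combination of nonempty closed paths, by multiplication by a ghost path. -/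
lemma exists_ghostPathEl_mul_eq {u v : V} {b : LPAU K s r} (hb : b ∈ pathSpan K s r u v)
    (hb0 : b ≠ 0) :
    ∃ (a : List E) (k : K), IsPathFrom s r u v a ∧ k ≠ 0 ∧
      ∃ z ∈ closedPathSpan K s r v, ghostPathEl K s r u a * b = k • vertexEl K s r v + z := by
  classical
  obtain ⟨l, hl, rfl⟩ := (Finsupp.mem_span_image_iff_linearCombination K).1 hb
  have hl0 : l.support.Nonempty := by
    rw [Finsupp.support_nonempty_iff]
    rintro rfl
    simp at hb0
  obtain ⟨a, ha, hmin⟩ := l.support.exists_min_image List.length hl0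
  have hpath : ∀ c ∈ l.support, IsPathFrom s r u v c := fun c hc => hl hc
  refine ⟨a, l a, hpath a ha, Finsupp.mem_support_iff.1 ha,
    ∑ c ∈ l.support.erase a, l c • (ghostPathEl K s r u a * pathEl K s r u c), ?_, ?_⟩
  · refine Submodule.sum_mem _ fun c hc => Submodule.smul_mem _ _ ?_
    obtain ⟨hca, hc⟩ := Finset.mem_erase.1 hc
    rcases ghostPathEl_mul_pathEl (K := K) (hpath a ha) (hpath c hc) (hmin c hc) with
      h | ⟨d, rfl, hd, h⟩
    · rw [h]
      exact zero_mem _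
    · rw [h]
      exact Submodule.subset_span ⟨d, ⟨fun h => hca (by simp [h]), hd⟩, rfl⟩
  · rw [Finsupp.linearCombination_apply, Finsupp.sum, ← Finset.add_sum_erase _ _ ha, mul_add,
      mul_smul_comm, ghostPathEl_mul_pathEl_self (hpath a ha), Finset.mul_sum]
    simp only [mul_smul_comm]

lemma reducible_of_mem_pathSpan {u v : V} {b : LPAU K s r} (hb : b ∈ pathSpan K s r u v)
    (hb0 : b ≠ 0) : Reducible K s r u v b := by
  obtain ⟨a, k, ha, hk, z, hz, h⟩ := exists_ghostPathEl_mul_eq hb hb0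
  apply Reducible.of_ghostPathEl_mul ha
  rw [h]
  exact reducible_smul_vertexEl_add hk hz

variable (K s r) in
/-- The span of the monomials `α β*` with `α` starting at `u`, `β` starting at `v` and `β` of
length at most `n`. -/
def monomialSpan (n : ℕ) (u v : V) : Submodule K (LPAU K s r) :=
  Submodule.span K {x | ∃ (w : V) (a b : List E), IsPathFrom s r u w a ∧ IsPathFrom s r v w b ∧
    b.length ≤ n ∧ x = pathEl K s r u a * ghostPathEl K s r v b}

lemma monomialSpan_mono {m n : ℕ} (h : m ≤ n) (u v : V) :
    monomialSpan K s r m u v ≤ monomialSpan K s r n u v := by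
  apply Submodule.span_mono
  rintro x ⟨w, a, b, ha, hb, hm, rfl⟩
  exact ⟨w, a, b, ha, hb, hm.trans h, rfl⟩

lemma mul_vertexEl_of_mem_monomialSpan {n : ℕ} {u v : V} {y : LPAU K s r}
    (hy : y ∈ monomialSpan K s r n u v) : y * vertexEl K s r v = y := by
  induction hy using Submodule.span_induction with
  | mem x hx =>
    obtain ⟨w, a, b, -, -, -, rfl⟩ := hx
    rw [mul_assoc, ghostPathEl_mul_vertexEl]
  | zero => simp
  | add x y _ _ hx hy => rw [add_mul, hx, hy]
  | smul k x _ hx => rw [smul_mul_assoc, hx]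

lemma mul_edgeEl_mem_monomialSpan {n : ℕ} {u : V} {e : E} {y : LPAU K s r}
    (hy : y ∈ monomialSpan K s r (n + 1) u (s e)) :
    y * edgeEl K s r e ∈ monomialSpan K s r n u (r e) := by
  induction hy using Submodule.span_induction with
  | mem x hx =>
    obtain ⟨w, a, b, ha, hb, hn, rfl⟩ := hx
    cases b with
    | nil =>
      obtain rfl := isPathFrom_nil_iff.1 hb
      refine Submodule.subset_span ⟨r e, a ++ [e], [], ha.append (.single e), .nil _,
        by simp, ?_⟩
      rw [ghostPathEl_nil, ghostPathEl_nil, pathEl_append ha, pathEl_cons, pathEl_nil, mul_assoc,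
        mul_assoc, vertexEl_mul_edgeEl, mul_assoc, vertexEl_mul_self, edgeEl_mul_vertexEl]
    | cons f b =>
      obtain ⟨hf, hb'⟩ := isPathFrom_cons_iff.1 hb
      rw [← hf, ghostPathEl_cons, mul_assoc, mul_assoc]
      by_cases hfe : f = e
      · subst hfe
        rw [ghostEl_mul_edgeEl_self, ghostPathEl_mul_vertexEl]
        exact Submodule.subset_span ⟨w, a, b, ha, hb', by simpa using hn, rfl⟩
      · rw [ghostEl_mul_edgeEl_of_ne s r hfe, mul_zero, mul_zero]
        exact zero_mem _
  | zero => simp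
  | add x y _ _ hx hy => rw [add_mul]; exact add_mem hx hy
  | smul k x _ hx => rw [smul_mul_assoc]; exact Submodule.smul_mem _ _ hx

/-- Every element of `monomialSpan` differs from a combination of paths by an element that is
fixed by right multiplication by `∑ e e*`, for every large enough finite set of edges. -/
lemma exists_sub_mul_sum_eq {n : ℕ} {u v : V} {y : LPAU K s r}
    (hy : y ∈ monomialSpan K s r n u v) :
    ∃ b ∈ pathSpan K s r u v, ∃ F : Finset E, ∀ F', F ⊆ F' →
      (y - b) * ∑ e ∈ F', edgeEl K s r e * ghostEl K s r e = y - b := by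
  classical
  induction hy using Submodule.span_induction with
  | mem x hx =>
    obtain ⟨w, a, b, ha, hb, -, rfl⟩ := hx
    cases b with
    | nil =>
      obtain rfl := isPathFrom_nil_iff.1 hb
      refine ⟨_, Submodule.subset_span ⟨a, ha, rfl⟩, ∅, fun F' _ => ?_⟩
      rw [ghostPathEl_nil, pathEl_mul_vertexEl ha, sub_self, zero_mul]
    | cons f b =>
      obtain ⟨rfl, hb⟩ := isPathFrom_cons_iff.1 hb
      refine ⟨0, zero_mem _, {f}, fun F' hF => ?_⟩
      rw [sub_zero, ghostPathEl_cons, Finset.mul_sum,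
        Finset.sum_eq_single_of_mem f (by simpa using hF)]
      · simp only [mul_assoc]
        rw [← mul_assoc (ghostEl K s r f), ghostEl_mul_edgeEl_self, vertexEl_mul_ghostEl]
      · intro e _ he
        simp only [mul_assoc]
        rw [← mul_assoc (ghostEl K s r f), ghostEl_mul_edgeEl_of_ne s r he.symm]
        simp
  | zero => exact ⟨0, zero_mem _, ∅, by simp⟩
  | add x y _ _ hx hy =>
    obtain ⟨b, hb, F, hF⟩ := hx
    obtain ⟨c, hc, G, hG⟩ := hy
    refine ⟨b + c, add_mem hb hc, F ∪ G, fun F' h => ?_⟩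
    rw [add_sub_add_comm, add_mul, hF F' (Finset.union_subset_left h),
      hG F' (Finset.union_subset_right h)]
  | smul k x _ hx =>
    obtain ⟨b, hb, F, hF⟩ := hx
    refine ⟨k • b, Submodule.smul_mem _ _ hb, F, fun F' h => ?_⟩
    rw [← smul_sub, smul_mul_assoc, hF F' h]

lemma mul_edgeEl_of_mul_vertexEl_of_ne {v : V} {e : E} {y : LPAU K s r}
    (hy : y * vertexEl K s r v = y) (he : v ≠ s e) : y * edgeEl K s r e = 0 := by
  rw [← hy, mul_assoc, vertexEl_mul_edgeEl_of_ne he, mul_zero]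

/-- A nonzero element annihilated on the right by all edges is reducible. -/
lemma reducible_of_mul_edgeEl_eq_zero {n : ℕ} {u v : V} {y : LPAU K s r}
    (hy : y ∈ monomialSpan K s r n u v) (hy0 : y ≠ 0)
    (h : ∀ e, y * edgeEl K s r e = 0) : Reducible K s r u v y := by
  classical
  have hyv := mul_vertexEl_of_mem_monomialSpan hy
  obtain ⟨b, hb, F, hF⟩ := exists_sub_mul_sum_eq hy
  have hyF : ∀ F' : Finset E, y * ∑ e ∈ F', edgeEl K s r e * ghostEl K s r e = 0 := fun F' => by
    rw [Finset.mul_sum]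
    exact Finset.sum_eq_zero fun e _ => by rw [← mul_assoc, h, zero_mul]
  have hyb : y = b - b * ∑ e ∈ F, edgeEl K s r e * ghostEl K s r e := by
    have := hF F subset_rfl
    rw [sub_mul, hyF, zero_sub, eq_sub_iff_add_eq] at this
    rw [← this]
    abel
  have hb0 : b ≠ 0 := by
    rintro rfl
    exact hy0 (by simpa using hyb)
  by_cases hfin : {e : E | s e = v}.Finite
  · rcases {e : E | s e = v}.eq_empty_or_nonempty with hempty | hne
    · have hbv := mul_vertexEl_of_mem_pathSpan hb
      rw [Finset.mul_sum, Finset.sum_eq_zero, sub_zero] at hyb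
      · rw [hyb]
        exact reducible_of_mem_pathSpan hb hb0
      · intro e _
        rw [← mul_assoc, mul_edgeEl_of_mul_vertexEl_of_ne hbv, zero_mul]
        exact fun he => Set.eq_empty_iff_forall_notMem.1 hempty e he.symm
    · refine absurd ?_ hy0
      rw [← hyv, vertexEl_eq_sum s r v hfin hne, hyF]
  · obtain ⟨a, k, ha, hk, z, hz, hab⟩ := exists_ghostPathEl_mul_eq hb hb0
    obtain ⟨H, hH⟩ := exists_finset_ghostEl_mul_eq_zero hz
    obtain ⟨f, hfv, hfFH⟩ := Set.Infinite.exists_notMem_finset hfin (F ∪ H)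
    simp only [Finset.mem_union, not_or] at hfFH
    obtain rfl : s f = v := hfv
    have hyf : y * edgeEl K s r f = b * edgeEl K s r f := by
      rw [hyb, sub_mul, mul_assoc, Finset.sum_mul, Finset.sum_eq_zero, mul_zero, sub_zero]
      intro e he
      rw [mul_assoc, ghostEl_mul_edgeEl_of_ne, mul_zero]
      rintro rfl
      exact hfFH.1 he
    apply Reducible.of_ghostPathEl_mul ha
    apply Reducible.of_ghostEl_mul
    apply Reducible.of_mul_edgeEl
    have : ghostEl K s r f * (ghostPathEl K s r u a * y) * edgeEl K s r f =
        k • vertexEl K s r (r f) := by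
      rw [mul_assoc, mul_assoc, hyf, ← mul_assoc (ghostPathEl K s r u a), hab, ← mul_assoc,
        mul_add, hH f hfFH.2, add_zero, mul_smul_comm, smul_mul_assoc, ghostEl_mul_vertexEl,
        ghostEl_mul_edgeEl_self]
    rw [this]
    exact reducible_smul_vertexEl _ hk

lemma reducible_of_mem_monomialSpan {n : ℕ} {u v : V} {y : LPAU K s r}
    (hy : y ∈ monomialSpan K s r n u v) (hy0 : y ≠ 0) : Reducible K s r u v y := by
  induction n generalizing v y with
  | zero =>
    refine reducible_of_mem_pathSpan ?_ hy0
    refine Submodule.span_le.2 ?_ hy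
    rintro x ⟨w, a, b, ha, hb, hn, rfl⟩
    obtain rfl : b = [] := by simpa using hn
    obtain rfl := isPathFrom_nil_iff.1 hb
    rw [ghostPathEl_nil, pathEl_mul_vertexEl ha]
    exact Submodule.subset_span ⟨a, ha, rfl⟩
  | succ n ih =>
    by_cases h : ∀ e, y * edgeEl K s r e = 0
    · exact reducible_of_mul_edgeEl_eq_zero hy hy0 h
    · push Not at h
      obtain ⟨e, he⟩ := h
      obtain rfl : v = s e := by
        by_contra hne
        exact he (mul_edgeEl_of_mul_vertexEl_of_ne (mul_vertexEl_of_mem_monomialSpan hy) hne)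
      exact (ih (mul_edgeEl_mem_monomialSpan hy) he).of_mul_edgeEl

end Reduction

section Span

/-- The monomials `α β*` for paths `α` and `β` with the same range. -/
def monomials : Set (LPAU K s r) :=
  {x | ∃ (u v w : V) (a b : List E), IsPathFrom s r u w a ∧ IsPathFrom s r v w b ∧
    x = pathEl K s r u a * ghostPathEl K s r v b}

variable {K} {s r}

lemma vertexEl_mem_monomials (v : V) : vertexEl K s r v ∈ monomials K s r :=
  ⟨v, v, v, [], [], .nil v, .nil v, by simp [vertexEl_mul_self]⟩

lemma edgeEl_mem_monomials (e : E) : edgeEl K s r e ∈ monomials K s r :=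
  ⟨s e, r e, r e, [e], [], .single e, .nil _,
    by simp [pathEl_cons, edgeEl_mul_vertexEl]⟩

lemma ghostEl_mem_monomials (e : E) : ghostEl K s r e ∈ monomials K s r :=
  ⟨r e, s e, r e, [], [e], .nil _, .single e,
    by simp [ghostPathEl_cons, vertexEl_mul_ghostEl]⟩

lemma gen_mul_mem_span_monomials (g : LPAGen V E) {x : LPAU K s r} (hx : x ∈ monomials K s r) :
    gen K s r g * x ∈ Submodule.span K (monomials K s r) := by
  obtain ⟨u, v, w, a, b, ha, hb, rfl⟩ := hx
  rw [← mul_assoc]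
  cases g with
  | vertex v' =>
    change vertexEl K s r v' * _ * _ ∈ _
    by_cases h : v' = u
    · subst h
      rw [vertexEl_mul_pathEl]
      exact Submodule.subset_span ⟨_, v, w, a, b, ha, hb, rfl⟩
    · rw [vertexEl_mul_pathEl_of_ne h, zero_mul]
      exact zero_mem _
  | edge e =>
    change edgeEl K s r e * _ * _ ∈ _
    by_cases h : r e = u
    · subst h
      rw [← pathEl_cons]
      exact Submodule.subset_span ⟨_, v, w, e :: a, b, .cons e ha, hb, rfl⟩
    · rw [← vertexEl_mul_pathEl, ← mul_assoc, edgeEl_mul_vertexEl_of_ne h, zero_mul, zero_mul]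
      exact zero_mem _
  | ghost e =>
    change ghostEl K s r e * _ * _ ∈ _
    by_cases h : s e = u
    · subst h
      cases a with
      | nil =>
        obtain rfl := isPathFrom_nil_iff.1 ha
        refine Submodule.subset_span ⟨r e, v, r e, [], b ++ [e], .nil _, hb.append (.single e), ?_⟩
        rw [ghostPathEl_concat, pathEl_nil, pathEl_nil, ghostEl_mul_vertexEl, ← mul_assoc,
          vertexEl_mul_ghostEl]
      | cons f a =>
        by_cases hef : e = f
        · subst hef
          rw [pathEl_cons, ← mul_assoc, ghostEl_mul_edgeEl_self, vertexEl_mul_pathEl]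
          exact Submodule.subset_span ⟨_, v, w, a, b, (isPathFrom_cons_iff.1 ha).2, hb, rfl⟩
        · rw [ghostEl_mul_pathEl_of_ne hef ha, zero_mul]
          exact zero_mem _
    · rw [← vertexEl_mul_pathEl, ← mul_assoc, ghostEl_mul_vertexEl_of_ne h, zero_mul, zero_mul]
      exact zero_mem _

lemma mem_span_monomials_of_mem_lpa {x : LPAU K s r} (hx : x ∈ lpa K s r) :
    x ∈ Submodule.span K (monomials K s r) := by
  suffices h : x ∈ Submodule.span K (monomials K s r) ∧
      ∀ t ∈ Submodule.span K (monomials K s r), x * t ∈ Submodule.span K (monomials K s r) from h.1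
  induction hx using NonUnitalAlgebra.adjoin_induction with
  | mem x hx =>
    obtain ⟨g, rfl⟩ := hx
    refine ⟨Submodule.subset_span ?_, fun t ht => ?_⟩
    · cases g with
      | vertex v => exact vertexEl_mem_monomials v
      | edge e => exact edgeEl_mem_monomials e
      | ghost e => exact ghostEl_mem_monomials e
    · induction ht using Submodule.span_induction with
      | mem t ht => exact gen_mul_mem_span_monomials g ht
      | zero => simp
      | add t t' _ _ h h' => rw [mul_add]; exact add_mem h h'
      | smul k t _ h => rw [mul_smul_comm]; exact Submodule.smul_mem _ _ h
  | add x y _ _ hx hy =>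
    exact ⟨add_mem hx.1 hy.1, fun t ht => by rw [add_mul]; exact add_mem (hx.2 t ht) (hy.2 t ht)⟩
  | zero => simp
  | mul x y _ _ hx hy =>
    exact ⟨hx.2 y hy.1, fun t ht => by rw [mul_assoc]; exact hx.2 _ (hy.2 t ht)⟩
  | smul k x _ hx =>
    exact ⟨Submodule.smul_mem _ _ hx.1, fun t ht => by
      rw [smul_mul_assoc]; exact Submodule.smul_mem _ _ (hx.2 t ht)⟩

lemma exists_vertexEl_mul_mul_mem_monomialSpan {x : LPAU K s r}
    (hx : x ∈ Submodule.span K (monomials K s r)) (u v : V) :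
    ∃ n, vertexEl K s r u * x * vertexEl K s r v ∈ monomialSpan K s r n u v := by
  induction hx using Submodule.span_induction with
  | mem x hx =>
    obtain ⟨u', v', w, a, b, ha, hb, rfl⟩ := hx
    refine ⟨b.length, ?_⟩
    rw [← mul_assoc, mul_assoc _ (ghostPathEl K s r v' b)]
    by_cases hu : u = u'
    · by_cases hv : v' = v
      · subst hu hv
        rw [vertexEl_mul_pathEl, ghostPathEl_mul_vertexEl]
        exact Submodule.subset_span ⟨w, a, b, ha, hb, le_rfl, rfl⟩
      · rw [ghostPathEl_mul_vertexEl_of_ne hv, mul_zero]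
        exact zero_mem _
    · rw [vertexEl_mul_pathEl_of_ne hu, zero_mul]
      exact zero_mem _
  | zero => exact ⟨0, by simp⟩
  | add x y _ _ hx hy =>
    obtain ⟨m, hm⟩ := hx
    obtain ⟨n, hn⟩ := hy
    refine ⟨max m n, ?_⟩
    rw [mul_add, add_mul]
    exact add_mem (monomialSpan_mono (le_max_left m n) u v hm)
      (monomialSpan_mono (le_max_right m n) u v hn)
  | smul k x _ hx =>
    obtain ⟨n, hn⟩ := hx
    refine ⟨n, ?_⟩
    rw [mul_smul_comm, smul_mul_assoc]
    exact Submodule.smul_mem _ _ hn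

/-- Finite sums of vertices act as local units. -/
lemma exists_sum_vertexEl_mul_mul_eq {x : LPAU K s r}
    (hx : x ∈ Submodule.span K (monomials K s r)) :
    ∃ F : Finset V, ∀ F', F ⊆ F' →
      (∑ u ∈ F', vertexEl K s r u) * x * (∑ v ∈ F', vertexEl K s r v) = x := by
  classical
  induction hx using Submodule.span_induction with
  | mem x hx =>
    obtain ⟨u, v, w, a, b, ha, hb, rfl⟩ := hx
    refine ⟨{u, v}, fun F' h => ?_⟩
    rw [← mul_assoc, mul_assoc _ (ghostPathEl K s r v b), Finset.sum_mul, Finset.mul_sum,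
      Finset.sum_eq_single_of_mem u (h (by simp)), Finset.sum_eq_single_of_mem v (h (by simp)),
      vertexEl_mul_pathEl, ghostPathEl_mul_vertexEl]
    · exact fun v' _ hv => ghostPathEl_mul_vertexEl_of_ne hv.symm b
    · exact fun u' _ hu => vertexEl_mul_pathEl_of_ne hu a
  | zero => exact ⟨∅, by simp⟩
  | add x y _ _ hx hy =>
    obtain ⟨F, hF⟩ := hx
    obtain ⟨G, hG⟩ := hy
    refine ⟨F ∪ G, fun F' h => ?_⟩
    rw [mul_add, add_mul, hF F' (Finset.union_subset_left h), hG F' (Finset.union_subset_right h)]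
  | smul k x _ hx =>
    obtain ⟨F, hF⟩ := hx
    exact ⟨F, fun F' h => by rw [mul_smul_comm, smul_mul_assoc, hF F' h]⟩

lemma exists_vertexEl_mul_mul_ne_zero {x : LPAU K s r}
    (hx : x ∈ Submodule.span K (monomials K s r)) (hx0 : x ≠ 0) :
    ∃ u v, vertexEl K s r u * x * vertexEl K s r v ≠ 0 := by
  by_contra! h
  obtain ⟨F, hF⟩ := exists_sum_vertexEl_mul_mul_eq hx
  apply hx0
  rw [← hF F subset_rfl, Finset.sum_mul, Finset.sum_mul]
  refine Finset.sum_eq_zero fun u _ => ?_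
  rw [Finset.mul_sum]
  exact Finset.sum_eq_zero fun v _ => h u v

end Span

/-- **The Reduction Theorem.**  For any graph `E`, any field `K`, and any nonzero
`x ∈ L_K(E)`, there exist paths `α, β` in `E` such that either `α* x β = k v` for some
vertex `v` and nonzero scalar `k`, or `α* x β = p(c)` for some cycle `c` without an exit
and some nonzero Laurent polynomial `p` over `K` (evaluated at `c`, with negative powers
interpreted via the ghost path `c*` and `c⁰ = s(c)`). -/
theorem reduction_theorem (K V E : Type) [Field K] (s r : E → V)
    (x : LPAU K s r) (hx : x ∈ lpa K s r) (hx0 : x ≠ 0) :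
    ∃ (va wa vb wb : V) (esa esb : List E),
      IsPathFrom s r va wa esa ∧ IsPathFrom s r vb wb esb ∧
      ((∃ (v : V) (k : K), k ≠ 0 ∧
          ghostPathEl K s r va esa * x * pathEl K s r vb esb = k • vertexEl K s r v) ∨
        (∃ (v : V) (esc : List E), IsCycle s r v esc ∧ ¬ HasExit s esc ∧
          ∃ p : ℤ →₀ K, p ≠ 0 ∧
            ghostPathEl K s r va esa * x * pathEl K s r vb esb =
              p.sum fun i k => k • cyclePow K s r v esc i)) := by
  have hx' := mem_span_monomials_of_mem_lpa hx
  obtain ⟨u, v, huv⟩ := exists_vertexEl_mul_mul_ne_zero hx' hx0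
  obtain ⟨n, hn⟩ := exists_vertexEl_mul_mul_mem_monomialSpan hx' u v
  obtain ⟨wa, wb, a, b, ha, hb, h⟩ := reducible_of_mem_monomialSpan hn huv
  have key : ghostPathEl K s r u a * (vertexEl K s r u * x * vertexEl K s r v) *
      pathEl K s r v b = ghostPathEl K s r u a * x * pathEl K s r v b := by
    rw [← mul_assoc, ← mul_assoc, ghostPathEl_mul_vertexEl, mul_assoc _ (vertexEl K s r v),
      vertexEl_mul_pathEl]
  rw [key] at h
  exact ⟨u, wa, v, wb, a, b, ha, hb, h⟩
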